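/- arXiv:1106.0127 — 2 statements merged into one kernel-verified Lean document; each statement's English description precedes it below -/
import Mathlib

section
/- There is a constant C′ > 0 such that for all t ∈ ℝ: |Θ(t,1) − Θ(1,1)| ≤ C′(|t|+1)^{γ−1}|t−1| and |Θ(t,−1) − Θ(−1,−1)| ≤ C′(|t|+1)^{γ−1}|t+1|. Consequently, |Θ(x,x) − Θ(y,x)| ≤ C″(|x|+|y|)^{γ−1}|x−y| for all x,y ∈ ℝ and some constant C″ > 0. -/
open Real

/-- A positively homogeneous function vanishes at the origin. -/
theorem homogeneous_zero {γ : ℝ} (hγ : 1 ≤ γ) {Θ : ℝ → ℝ → ℝ}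
    (hhom : ∀ t x y : ℝ, 0 < t → Θ (t * x) (t * y) = t ^ γ * Θ x y) : Θ 0 0 = 0 := by
  have h := hhom 2 0 0 (by norm_num)
  have h2 : (2 : ℝ) ≤ 2 ^ γ := by
    simpa using rpow_le_rpow_of_exponent_le (x := 2) (by norm_num) hγ
  rw [mul_zero] at h
  have h3 : ((2 : ℝ) ^ γ - 1) * Θ 0 0 = 0 := by linarith
  rcases mul_eq_zero.mp h3 with h4 | h4
  · linarith
  · exact h4

/-- A homogeneous function with values in `[0, C]` on the unit circle
has growth at most `C * (|x| + |y|) ^ γ`. -/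
theorem homogeneous_growth {γ : ℝ} (hγ : 1 ≤ γ) {Θ : ℝ → ℝ → ℝ}
    (hhom : ∀ t x y : ℝ, 0 < t → Θ (t * x) (t * y) = t ^ γ * Θ x y)
    {C : ℝ} (hC : 0 ≤ C)
    (hlow : ∀ x y : ℝ, x ^ 2 + y ^ 2 = 1 → 0 ≤ Θ x y)
    (hupp : ∀ x y : ℝ, x ^ 2 + y ^ 2 = 1 → Θ x y ≤ C) (x y : ℝ) :
    0 ≤ Θ x y ∧ Θ x y ≤ C * (|x| + |y|) ^ γ := by
  rcases eq_or_lt_of_le (by positivity : 0 ≤ x ^ 2 + y ^ 2) with h0 | h0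
  · have hx : x = 0 := by nlinarith [sq_nonneg x, sq_nonneg y]
    have hy : y = 0 := by nlinarith [sq_nonneg x, sq_nonneg y]
    subst hx hy
    rw [homogeneous_zero hγ hhom]
    exact ⟨le_rfl, by positivity⟩
  · set r := √(x ^ 2 + y ^ 2) with hr
    have hrpos : 0 < r := sqrt_pos.mpr h0
    have hrsq : r ^ 2 = x ^ 2 + y ^ 2 := sq_sqrt h0.le
    have hcirc : (x / r) ^ 2 + (y / r) ^ 2 = 1 := by
      field_simp
      linarith
    have heq := hhom r (x / r) (y / r) hrpos
    rw [mul_div_cancel₀ x hrpos.ne', mul_div_cancel₀ y hrpos.ne'] at heq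
    have hle : r ≤ |x| + |y| := by
      apply le_of_sq_le_sq _ (by positivity)
      nlinarith [sq_abs x, sq_abs y, mul_nonneg (abs_nonneg x) (abs_nonneg y)]
    have hpow : r ^ γ ≤ (|x| + |y|) ^ γ := rpow_le_rpow hrpos.le hle (by linarith)
    have hrγ : 0 ≤ r ^ γ := by positivity
    rw [heq]
    refine ⟨mul_nonneg hrγ (hlow _ _ hcirc), ?_⟩
    calc r ^ γ * Θ (x / r) (y / r) ≤ r ^ γ * C := by gcongr; exact hupp _ _ hcirc
      _ ≤ (|x| + |y|) ^ γ * C := by gcongr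
      _ = C * (|x| + |y|) ^ γ := mul_comm _ _

/-- A local Lipschitz estimate at a point `s = ±1` together with growth of order `γ`
yields a global weighted Lipschitz estimate. -/
theorem abs_sub_le_of_local_lipschitz {γ : ℝ} (hγ : 1 ≤ γ) {Θ : ℝ → ℝ → ℝ} {C : ℝ} (hC : 0 ≤ C)
    (hgrowth : ∀ x y : ℝ, 0 ≤ Θ x y ∧ Θ x y ≤ C * (|x| + |y|) ^ γ)
    {ε L s : ℝ} (hε : 0 < ε) (hL : 0 ≤ L) (hs : |s| = 1)
    (hlip : ∀ t : ℝ, |t - s| < ε → |Θ t s - Θ s s| ≤ L * |t - s|) (t : ℝ) :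
    |Θ t s - Θ s s| ≤ (L + C * 2 ^ γ * (1 + 2 / ε)) * (|t| + 1) ^ (γ - 1) * |t - s| := by
  have hbase : 1 ≤ |t| + 1 := by linarith [abs_nonneg t]
  have hw : 1 ≤ (|t| + 1) ^ (γ - 1) := one_le_rpow hbase (by linarith)
  have hK : 0 ≤ C * 2 ^ γ * (1 + 2 / ε) := by positivity
  rcases lt_or_ge |t - s| ε with hnear | hfar
  · refine (hlip t hnear).trans ?_
    gcongr
    nlinarith
  · have hsplit : (|t| + 1) ^ γ = (|t| + 1) ^ (γ - 1) * (|t| + 1) := by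
      rw [← rpow_add_one (by positivity), sub_add_cancel]
    have hdist : |t| + 1 ≤ (1 + 2 / ε) * |t - s| := by
      have h1 : |t| ≤ |t - s| + |s| := by simpa using abs_add_le (t - s) s
      have h2 : 2 ≤ 2 / ε * |t - s| := by
        rw [div_mul_eq_mul_div, le_div_iff₀ hε]
        linarith
      linarith
    have h2γ : (1 : ℝ) ≤ 2 ^ γ := one_le_rpow (by norm_num) (by linarith)
    have htγ : (1 : ℝ) ≤ (|t| + 1) ^ γ := one_le_rpow hbase (by linarith)
    have hΘt := hgrowth t s
    have hΘs := hgrowth s s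
    rw [hs] at hΘt hΘs
    rw [one_add_one_eq_two] at hΘs
    have hdiff : |Θ t s - Θ s s| ≤ C * 2 ^ γ * (|t| + 1) ^ γ := by
      have h1 : C * (|t| + 1) ^ γ ≤ C * 2 ^ γ * (|t| + 1) ^ γ := by
        gcongr
        exact le_mul_of_one_le_right hC h2γ
      have h2 : C * 2 ^ γ ≤ C * 2 ^ γ * (|t| + 1) ^ γ :=
        le_mul_of_one_le_right (by positivity) htγ
      rw [abs_le]
      constructor <;> linarith
    calc |Θ t s - Θ s s| ≤ C * 2 ^ γ * ((|t| + 1) ^ (γ - 1) * (|t| + 1)) := hsplit ▸ hdiff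
      _ ≤ C * 2 ^ γ * ((|t| + 1) ^ (γ - 1) * ((1 + 2 / ε) * |t - s|)) := by gcongr
      _ = C * 2 ^ γ * (1 + 2 / ε) * (|t| + 1) ^ (γ - 1) * |t - s| := by ring
      _ ≤ _ := by gcongr; linarith

/-- Rescaling by `r > 0` transports the estimate at `(s, s)` to `(r * s, r * s)`. -/
theorem abs_sub_le_of_homogeneous {γ : ℝ} {Θ : ℝ → ℝ → ℝ}
    (hhom : ∀ t x y : ℝ, 0 < t → Θ (t * x) (t * y) = t ^ γ * Θ x y) {K s : ℝ}
    (hK : ∀ t : ℝ, |Θ t s - Θ s s| ≤ K * (|t| + 1) ^ (γ - 1) * |t - s|)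
    {r : ℝ} (hr : 0 < r) (y : ℝ) :
    |Θ (r * s) (r * s) - Θ y (r * s)| ≤ K * (r + |y|) ^ (γ - 1) * |r * s - y| := by
  have hy : r * (y / r) = y := mul_div_cancel₀ y hr.ne'
  have hΘ : Θ y (r * s) = r ^ γ * Θ (y / r) s := by rw [← hhom r _ _ hr, hy]
  have hsum : r + |y| = r * (|y / r| + 1) := by
    rw [abs_div, abs_of_pos hr]
    field_simp
    ring
  have hdist : |r * s - y| = r * |y / r - s| := by
    rw [← abs_of_pos hr, ← abs_mul, abs_of_pos hr, mul_sub, hy, abs_sub_comm]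
  have hpow : r ^ γ = r ^ (γ - 1) * r := by
    rw [← rpow_add_one hr.ne', sub_add_cancel]
  rw [hhom r s s hr, hΘ, ← mul_sub, abs_mul, abs_sub_comm, abs_of_pos (by positivity), hsum, hdist,
    mul_rpow hr.le (by positivity), hpow]
  calc r ^ (γ - 1) * r * |Θ (y / r) s - Θ s s|
      ≤ r ^ (γ - 1) * r * (K * (|y / r| + 1) ^ (γ - 1) * |y / r - s|) := by gcongr; exact hK _
    _ = _ := by ring

/-- Under the assumptions on `Θ` (homogeneity of degree `γ ≥ 1`, symmetry,
two-sided bounds on the unit circle, local Lipschitz conditions at `(1,1)` and `(-1,-1)`),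
there is `C' > 0` with `|Θ(t,1) − Θ(1,1)| ≤ C'(|t|+1)^{γ−1}|t−1|` and
`|Θ(t,−1) − Θ(−1,−1)| ≤ C'(|t|+1)^{γ−1}|t+1|` for all `t`; consequently there is `C'' > 0`
with `|Θ(x,x) − Θ(y,x)| ≤ C''(|x|+|y|)^{γ−1}|x−y|` for all `x, y`. -/
theorem statement6
    (γ : ℝ) (hγ : 1 ≤ γ)
    (Θ : ℝ → ℝ → ℝ)
    (hhom : ∀ t x y : ℝ, 0 < t → Θ (t * x) (t * y) = t ^ γ * Θ x y)
    (hsymm : ∀ x y : ℝ, Θ x y = Θ y x)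
    (c₀ C₀ : ℝ) (hc₀ : 0 < c₀) (hc₀C₀ : c₀ ≤ C₀)
    (hlow : ∀ x y : ℝ, x ^ 2 + y ^ 2 = 1 → c₀ ≤ Θ x y)
    (hupp : ∀ x y : ℝ, x ^ 2 + y ^ 2 = 1 → Θ x y ≤ C₀)
    (ε CL : ℝ) (hε : 0 < ε) (hCL : 0 < CL)
    (hlip1 : ∀ t : ℝ, t ∈ Set.Ioo (1 - ε) (1 + ε) → |Θ t 1 - Θ 1 1| ≤ CL * |t - 1|)
    (hlip2 : ∀ t : ℝ, t ∈ Set.Ioo (-1 - ε) (-1 + ε) → |Θ t (-1) - Θ (-1) (-1)| ≤ CL * |t + 1|) :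
    (∃ C' : ℝ, 0 < C' ∧ ∀ t : ℝ,
        |Θ t 1 - Θ 1 1| ≤ C' * (|t| + 1) ^ (γ - 1) * |t - 1| ∧
        |Θ t (-1) - Θ (-1) (-1)| ≤ C' * (|t| + 1) ^ (γ - 1) * |t + 1|) ∧
    (∃ C'' : ℝ, 0 < C'' ∧ ∀ x y : ℝ,
        |Θ x x - Θ y x| ≤ C'' * (|x| + |y|) ^ (γ - 1) * |x - y|) := by
  have hC₀ : 0 < C₀ := hc₀.trans_le hc₀C₀
  have hgrowth := homogeneous_growth hγ hhom hC₀.le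
    (fun x y h => hc₀.le.trans (hlow x y h)) hupp
  set K := CL + C₀ * 2 ^ γ * (1 + 2 / ε) with hKdef
  have hK : 0 < K := by positivity
  have h1 : ∀ t : ℝ, |Θ t 1 - Θ 1 1| ≤ K * (|t| + 1) ^ (γ - 1) * |t - 1| :=
    abs_sub_le_of_local_lipschitz hγ hC₀.le hgrowth hε hCL.le (by simp) fun t ht =>
      hlip1 t ⟨by linarith [(abs_lt.mp ht).1], by linarith [(abs_lt.mp ht).2]⟩
  have h2 : ∀ t : ℝ, |Θ t (-1) - Θ (-1) (-1)| ≤ K * (|t| + 1) ^ (γ - 1) * |t - -1| :=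
    abs_sub_le_of_local_lipschitz hγ hC₀.le hgrowth hε hCL.le (by simp) fun t ht => by
      rw [sub_neg_eq_add]
      exact hlip2 t ⟨by linarith [(abs_lt.mp ht).1], by linarith [(abs_lt.mp ht).2]⟩
  refine ⟨⟨K, hK, fun t => ⟨h1 t, by simpa using h2 t⟩⟩, K + C₀, by positivity, fun x y => ?_⟩
  have hweight : K * (|x| + |y|) ^ (γ - 1) * |x - y| ≤
      (K + C₀) * (|x| + |y|) ^ (γ - 1) * |x - y| := by
    gcongr
    linarith
  rcases lt_trichotomy x 0 with hx | rfl | hx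
  · refine le_trans ?_ hweight
    simpa [abs_of_neg hx] using abs_sub_le_of_homogeneous hhom h2 (neg_pos.mpr hx) y
  · have hy := hgrowth y 0
    rw [abs_zero, add_zero] at hy
    rw [homogeneous_zero hγ hhom, zero_sub, abs_neg, abs_of_nonneg hy.1, abs_zero, zero_add,
      zero_sub, abs_neg]
    rcases eq_or_ne y 0 with rfl | hy0
    · simp [homogeneous_zero hγ hhom]
    · have hpow : |y| ^ γ = |y| ^ (γ - 1) * |y| := by
        rw [← rpow_add_one (abs_pos.mpr hy0).ne', sub_add_cancel]
      rw [mul_assoc, ← hpow]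
      refine hy.2.trans ?_
      gcongr
      linarith
  · refine le_trans ?_ hweight
    simpa [abs_of_pos hx] using abs_sub_le_of_homogeneous hhom h1 hx y
end

section
/- For every κ ∈ (0,1], α > 0 and all x, ξ ∈ ℝ, the function r^{(2)}_α(x,ξ) = (α/g_α(x)) ∫₀^{|ξ|g_α(x)} (1 − e^{−αt}) dt satisfies 0 ≤ r^{(2)}_α(x,ξ) ≤ α|ξ| · g_α(x)^κ · min((α|ξ|)^κ, 1). -/
open Real

/-- A positively homogeneous function of positive degree, nonnegative on the unit circle, is
nonnegative on the diagonal. -/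
lemma diagonal_nonneg_of_homogeneous {γ : ℝ} (hγ : 0 < γ) {Θ : ℝ → ℝ → ℝ}
    (hhom : ∀ t x y : ℝ, 0 < t → Θ (t * x) (t * y) = t ^ γ * Θ x y)
    (hnonneg : ∀ x y : ℝ, x ^ 2 + y ^ 2 = 1 → 0 ≤ Θ x y) (x : ℝ) : 0 ≤ Θ x x := by
  rcases eq_or_ne x 0 with rfl | hx
  · have h := hhom 2 0 0 two_pos
    have h2 : (1 : ℝ) < 2 ^ γ := Real.one_lt_rpow one_lt_two hγ
    rw [mul_zero] at h
    have h0 : ((2 : ℝ) ^ γ - 1) * Θ 0 0 = 0 := by linarith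
    exact ((mul_eq_zero.mp h0).resolve_left (by linarith)).ge
  · have ht : 0 < √(x ^ 2 + x ^ 2) := Real.sqrt_pos.mpr (by positivity)
    have hsq : √(x ^ 2 + x ^ 2) ^ 2 = x ^ 2 + x ^ 2 := Real.sq_sqrt (by positivity)
    set t := √(x ^ 2 + x ^ 2)
    have h := hhom t (x / t) (x / t) ht
    rw [mul_div_cancel₀ x ht.ne'] at h
    rw [h]
    refine mul_nonneg (Real.rpow_nonneg ht.le γ) (hnonneg _ _ ?_)
    rw [div_pow, hsq]
    field_simp

lemma min_one_mul_le_rpow_mul_min {s g κ : ℝ} (hs : 0 ≤ s) (hg : 1 ≤ g) (hκ₀ : 0 ≤ κ)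
    (hκ₁ : κ ≤ 1) : min 1 (s * g) ≤ g ^ κ * min (s ^ κ) 1 := by
  have hg0 : 0 ≤ g := by linarith
  have hu : 0 ≤ s * g := mul_nonneg hs hg0
  rw [mul_min_of_nonneg _ _ (Real.rpow_nonneg hg0 κ), mul_one]
  refine le_min ?_ ((min_le_left _ _).trans (Real.one_le_rpow hg hκ₀))
  rw [mul_comm (g ^ κ), ← Real.mul_rpow hs hg0]
  rcases le_total (s * g) 1 with h | h
  · exact (min_le_right _ _).trans (Real.self_le_rpow_of_le_one hu h hκ₁)
  · exact (min_le_left _ _).trans (Real.one_le_rpow h hκ₀)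

lemma setIntegral_one_sub_exp_neg_nonneg {α : ℝ} (hα : 0 ≤ α) (L : ℝ) :
    0 ≤ ∫ t in Set.Ioc (0 : ℝ) L, (1 - Real.exp (-(α * t))) := by
  refine MeasureTheory.setIntegral_nonneg measurableSet_Ioc fun t ht => ?_
  have : 0 ≤ α * t := mul_nonneg hα ht.1.le
  exact sub_nonneg.mpr (Real.exp_le_one_iff.mpr (by linarith))

lemma setIntegral_one_sub_exp_neg_le {α L : ℝ} (hα : 0 ≤ α) (hL : 0 ≤ L) :
    ∫ t in Set.Ioc (0 : ℝ) L, (1 - Real.exp (-(α * t))) ≤ L * min 1 (α * L) := by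
  have hint : MeasureTheory.IntegrableOn (fun t : ℝ => 1 - Real.exp (-(α * t)))
      (Set.Ioc 0 L) := Continuous.integrableOn_Ioc (by fun_prop)
  calc ∫ t in Set.Ioc (0 : ℝ) L, (1 - Real.exp (-(α * t)))
      ≤ ∫ _ in Set.Ioc (0 : ℝ) L, min 1 (α * L) := by
        refine MeasureTheory.setIntegral_mono_on hint
          (continuous_const.integrableOn_Ioc) measurableSet_Ioc fun t ht => le_min ?_ ?_
        · linarith [Real.exp_pos (-(α * t))]
        · linarith [Real.add_one_le_exp (-(α * t)), mul_le_mul_of_nonneg_left ht.2 hα]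
    _ = L * min 1 (α * L) := by simp [hL]

/-- With `θ(x) = Θ(x,x)` and `g_α(x) = (1+αθ(x))^{1/2}`, for every
`κ ∈ (0,1]`, `α > 0` and all `x, ξ`, the quantity
`r⁽²⁾_α(x,ξ) = (α/g_α(x)) ∫₀^{|ξ|g_α(x)} (1 − e^{−αt}) dt` satisfies
`0 ≤ r⁽²⁾_α(x,ξ) ≤ α|ξ| · g_α(x)^κ · min((α|ξ|)^κ, 1)`. -/
theorem statement9
    (γ : ℝ) (hγ : 0 < γ)
    (Θ : ℝ → ℝ → ℝ)
    (hhom : ∀ t x y : ℝ, 0 < t → Θ (t * x) (t * y) = t ^ γ * Θ x y)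
    (hsymm : ∀ x y : ℝ, Θ x y = Θ y x)
    (c₀ C₀ : ℝ) (hc₀ : 0 < c₀) (hc₀C₀ : c₀ ≤ C₀)
    (hlow : ∀ x y : ℝ, x ^ 2 + y ^ 2 = 1 → c₀ ≤ Θ x y)
    (hupp : ∀ x y : ℝ, x ^ 2 + y ^ 2 = 1 → Θ x y ≤ C₀)
    (θ : ℝ → ℝ) (hθ : ∀ x : ℝ, θ x = Θ x x)
    (g : ℝ → ℝ → ℝ) (hg : ∀ α x : ℝ, g α x = Real.sqrt (1 + α * θ x))
    (r₂ : ℝ → ℝ → ℝ → ℝ)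
    (hr₂ : ∀ α x ξ : ℝ, r₂ α x ξ =
      (α / g α x) * ∫ t in Set.Ioc (0 : ℝ) (|ξ| * g α x), (1 - Real.exp (-(α * t))))
    (κ : ℝ) (hκ₀ : 0 < κ) (hκ₁ : κ ≤ 1)
    (α : ℝ) (hα : 0 < α) (x ξ : ℝ) :
    0 ≤ r₂ α x ξ ∧
      r₂ α x ξ ≤ α * |ξ| * (g α x) ^ κ * min ((α * |ξ|) ^ κ) 1 := by
  have hθ0 : 0 ≤ θ x := hθ x ▸ diagonal_nonneg_of_homogeneous hγ hhom
    (fun a b h => hc₀.le.trans (hlow a b h)) x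
  have hg1 : 1 ≤ g α x := by
    rw [hg, Real.one_le_sqrt]
    linarith [mul_nonneg hα.le hθ0]
  have hgpos : 0 < g α x := by linarith
  have hs : 0 ≤ α * |ξ| := by positivity
  rw [hr₂]
  refine ⟨mul_nonneg (by positivity) (setIntegral_one_sub_exp_neg_nonneg hα.le _), ?_⟩
  calc α / g α x * ∫ t in Set.Ioc (0 : ℝ) (|ξ| * g α x), (1 - Real.exp (-(α * t)))
      ≤ α / g α x * (|ξ| * g α x * min 1 (α * (|ξ| * g α x))) := by
        gcongr
        exact setIntegral_one_sub_exp_neg_le hα.le (by positivity)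
    _ = α * |ξ| * min 1 (α * |ξ| * g α x) := by
        rw [← mul_assoc α]
        field_simp
    _ ≤ α * |ξ| * ((g α x) ^ κ * min ((α * |ξ|) ^ κ) 1) := by
        gcongr
        exact min_one_mul_le_rpow_mul_min hs hg1 hκ₀.le hκ₁
    _ = α * |ξ| * (g α x) ^ κ * min ((α * |ξ|) ^ κ) 1 := by ring
end
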